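/- arXiv:2402.11639 — 2 statements merged into one kernel-verified Lean document; each statement's English description precedes it below -/
import Mathlib

section
/- Let k ≥ 1, n ≥ 2, u ∈ S^{k−1}, α_1,…,α_n > 0, and reals c_a ≠ 0, c_u ≠ 0, σ ≥ 0. Let u_1,…,u_n be i.i.d. uniform on S^{k−1} and for c ∈ ℝ define J(c) := c_a²·c_u²·E[ Σ_{i=1}^n Σ_{j=1}^n (u_i − u)^⊤(u_j − u)·e^{c_u²·c·(u_i + u_j)^⊤ u}·α_i·α_j / ( Σ_{i=1}^n e^{c_u²·c·u_i^⊤ u}·α_i )² ] + σ²·E[ Σ_{i=1}^n e^{2·c_u²·c·u_i^⊤ u}·α_i² / ( Σ_{i=1}^n e^{c_u²·c·u_i^⊤ u}·α_i )² ]. Then for every δ > 0, the point c = 0 is not a minimizer of J over [0, δ]; that is, there exists c ∈ (0, δ] with J(c) < J(0). -/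
open MeasureTheory Real
open scoped RealInnerProductSpace

noncomputable section

/-- Uniform probability measure on the unit sphere `S^{k-1} ⊆ ℝ^k`, defined as the
normalized `(k-1)`-dimensional Hausdorff measure restricted to the sphere. -/
def sphereUniform (k : ℕ) : Measure (EuclideanSpace ℝ (Fin k)) :=
  ((μH[(k : ℝ) - 1]) (Metric.sphere (0 : EuclideanSpace ℝ (Fin k)) 1))⁻¹ •
    (μH[(k : ℝ) - 1]).restrict (Metric.sphere (0 : EuclideanSpace ℝ (Fin k)) 1)

/-- The function `J(c)` of Lemma 8: signal part plus noise part, where the expectation is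
over `u_1, …, u_n` i.i.d. uniform on `S^{k-1}`. -/
def Jloss (k n : ℕ) (u : EuclideanSpace ℝ (Fin k)) (α : Fin n → ℝ)
    (ca cu σ : ℝ) (c : ℝ) : ℝ :=
  ca ^ 2 * cu ^ 2 *
      ∫ us : Fin n → EuclideanSpace ℝ (Fin k),
        (∑ i : Fin n, ∑ j : Fin n,
            ⟪us i - u, us j - u⟫ * Real.exp (cu ^ 2 * c * ⟪us i + us j, u⟫) * α i * α j) /
          (∑ i : Fin n, Real.exp (cu ^ 2 * c * ⟪us i, u⟫) * α i) ^ 2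
        ∂(Measure.pi fun _ : Fin n => sphereUniform k) +
    σ ^ 2 *
      ∫ us : Fin n → EuclideanSpace ℝ (Fin k),
        (∑ i : Fin n, Real.exp (2 * cu ^ 2 * c * ⟪us i, u⟫) * α i ^ 2) /
          (∑ i : Fin n, Real.exp (cu ^ 2 * c * ⟪us i, u⟫) * α i) ^ 2
        ∂(Measure.pi fun _ : Fin n => sphereUniform k)

section SphereMeasure

variable {E : Type*} [NormedAddCommGroup E] [InnerProductSpace ℝ E] [FiniteDimensional ℝ E]
  [MeasurableSpace E] [BorelSpace E]

theorem hausdorffMeasure_pos_of_open_hemisphere {v : E} (hv : ‖v‖ = 1) {d : ℕ}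
    (hd : Module.finrank ℝ (ℝ ∙ v)ᗮ = d) :
    0 < μH[(d : ℝ)] {x : E | x ∈ Metric.sphere (0 : E) 1 ∧ 0 < ⟪x, v⟫} := by
  have hball : 0 < μH[(d : ℝ)] (Metric.ball (0 : (ℝ ∙ v)ᗮ) 1) := by
    rw [← hd]
    exact Metric.measure_ball_pos _ _ one_pos
  refine hball.trans_le ((measure_mono ?_).trans
    (hausdorffMeasure_orthogonalProjectionOnto_le (ℝ ∙ v)ᗮ (d : ℝ) _ (Nat.cast_nonneg d)))
  intro w hw
  have hw1 : ‖w‖ < 1 := by simpa using hw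
  have hpos : 0 < 1 - ‖w‖ ^ 2 := by nlinarith [norm_nonneg w]
  have hwv : ⟪(w : E), v⟫ = 0 := Submodule.mem_orthogonal_singleton_iff_inner_left.mp w.2
  refine ⟨(w : E) + √(1 - ‖w‖ ^ 2) • v, ⟨?_, ?_⟩, ?_⟩
  · have h : ‖(w : E) + √(1 - ‖w‖ ^ 2) • v‖ ^ 2 = 1 := by
      rw [norm_add_sq_real, inner_smul_right, hwv, norm_smul, hv, mul_one, Real.norm_eq_abs, sq_abs,
        Real.sq_sqrt hpos.le, Submodule.coe_norm]
      ring
    rw [mem_sphere_zero_iff_norm]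
    exact (pow_eq_one_iff_of_nonneg (norm_nonneg _) two_ne_zero).mp h
  · rw [inner_add_left, hwv, inner_smul_left, real_inner_self_eq_norm_sq, hv]
    simpa using hpos
  · rw [map_add, map_smul, Submodule.orthogonalProjectionOnto_orthogonalComplement_singleton_eq_zero,
      smul_zero, add_zero, Submodule.orthogonalProjectionOnto_mem_subspace_eq_self]

theorem hausdorffMeasure_closed_hemisphere_lt_top {v : E} (hv : ‖v‖ = 1) {d : ℕ}
    (hd : Module.finrank ℝ (ℝ ∙ v)ᗮ = d) :
    μH[(d : ℝ)] {x : E | x ∈ Metric.sphere (0 : E) 1 ∧ ⟪v, x⟫ ≤ 0} < ⊤ := by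
  set f : (ℝ ∙ v)ᗮ → E := fun w => stereoInvFunAux v (w : E)
  have hf : ContDiff ℝ 1 f := contDiff_stereoInvFunAux.comp (ℝ ∙ v)ᗮ.subtypeL.contDiff
  have hcompact : IsCompact (Metric.closedBall (0 : (ℝ ∙ v)ᗮ) 2) := isCompact_closedBall _ _
  obtain ⟨K, hK⟩ := hf.contDiffOn.exists_lipschitzOnWith one_ne_zero
    (convex_closedBall (0 : (ℝ ∙ v)ᗮ) 2) hcompact
  have hlt : μH[(d : ℝ)] (Metric.closedBall (0 : (ℝ ∙ v)ᗮ) 2) < ⊤ := by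
    rw [← hd]
    exact hcompact.measure_lt_top
  refine (measure_mono ?_).trans_lt ((hK.hausdorffMeasure_image_le (Nat.cast_nonneg d)).trans_lt
    (ENNReal.mul_lt_top (ENNReal.rpow_lt_top_of_nonneg (Nat.cast_nonneg d) ENNReal.coe_ne_top) hlt))
  rintro x ⟨hx, hvx⟩
  have hne : x ≠ v := by
    rintro rfl
    rw [real_inner_self_eq_norm_sq, hv] at hvx
    norm_num at hvx
  refine ⟨stereoToFun v x, ?_, congrArg Subtype.val (stereo_left_inv hv (x := ⟨x, hx⟩) hne)⟩
  have hproj : ‖(ℝ ∙ v)ᗮ.orthogonalProjectionOnto x‖ ≤ 1 :=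
    (Submodule.norm_orthogonalProjectionOnto_apply_le _ x).trans_eq (mem_sphere_zero_iff_norm.mp hx)
  have hfrac : |2 / (1 - ⟪v, x⟫)| ≤ 2 := by
    rw [abs_of_nonneg (by apply div_nonneg <;> linarith), div_le_iff₀ (by linarith)]
    linarith
  rw [mem_closedBall_zero_iff, stereoToFun_apply, norm_smul, innerSL_apply_apply, Real.norm_eq_abs]
  nlinarith [abs_nonneg (2 / (1 - ⟪v, x⟫)), norm_nonneg ((ℝ ∙ v)ᗮ.orthogonalProjectionOnto x)]

theorem hausdorffMeasure_sphere_lt_top {v : E} (hv : ‖v‖ = 1) {d : ℕ}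
    (hd : Module.finrank ℝ E = d + 1) :
    μH[(d : ℝ)] (Metric.sphere (0 : E) 1) < ⊤ := by
  have : Fact (Module.finrank ℝ E = d + 1) := ⟨hd⟩
  have hv0 : v ≠ 0 := by rintro rfl; simp at hv
  have hcover : Metric.sphere (0 : E) 1 ⊆
      {x : E | x ∈ Metric.sphere (0 : E) 1 ∧ ⟪v, x⟫ ≤ 0} ∪
        {x : E | x ∈ Metric.sphere (0 : E) 1 ∧ ⟪-v, x⟫ ≤ 0} := by
    intro x hx
    rcases le_total ⟪v, x⟫ 0 with h | h
    · exact Or.inl ⟨hx, h⟩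
    · exact Or.inr ⟨hx, by rw [inner_neg_left]; linarith⟩
  exact (measure_mono hcover).trans_lt (measure_union_lt_top
    (hausdorffMeasure_closed_hemisphere_lt_top hv (Submodule.finrank_orthogonal_span_singleton hv0))
    (hausdorffMeasure_closed_hemisphere_lt_top (by rwa [norm_neg])
      (Submodule.finrank_orthogonal_span_singleton (neg_ne_zero.mpr hv0))))

end SphereMeasure

section SphereUniform

variable {k : ℕ} {u : EuclideanSpace ℝ (Fin k)}

theorem hausdorffMeasure_euclidean_sphere_ne_top (hk : 1 ≤ k) (hu : ‖u‖ = 1) :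
    μH[(k : ℝ) - 1] (Metric.sphere (0 : EuclideanSpace ℝ (Fin k)) 1) ≠ ⊤ := by
  obtain ⟨d, rfl⟩ := Nat.exists_eq_add_of_le' hk
  have h := hausdorffMeasure_sphere_lt_top hu (d := d) (by simp)
  simpa using h.ne

theorem hausdorffMeasure_euclidean_open_hemisphere_ne_zero (hk : 1 ≤ k) (hu : ‖u‖ = 1) :
    μH[(k : ℝ) - 1] {x : EuclideanSpace ℝ (Fin k) | x ∈ Metric.sphere 0 1 ∧ 0 < ⟪x, u⟫} ≠ 0 := by
  obtain ⟨d, rfl⟩ := Nat.exists_eq_add_of_le' hk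
  have : Fact (Module.finrank ℝ (EuclideanSpace ℝ (Fin (d + 1))) = d + 1) := ⟨by simp⟩
  have h := hausdorffMeasure_pos_of_open_hemisphere hu (d := d)
    (Submodule.finrank_orthogonal_span_singleton (by rintro rfl; simp at hu))
  have hcast : ((d + 1 : ℕ) : ℝ) - 1 = d := by push_cast; ring
  rw [hcast]
  exact h.ne'

theorem isProbabilityMeasure_sphereUniform (hk : 1 ≤ k) (hu : ‖u‖ = 1) :
    IsProbabilityMeasure (sphereUniform k) := by
  refine ⟨?_⟩
  rw [sphereUniform, Measure.smul_apply, Measure.restrict_apply_univ, smul_eq_mul]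
  refine ENNReal.inv_mul_cancel ?_ (hausdorffMeasure_euclidean_sphere_ne_top hk hu)
  intro h
  exact hausdorffMeasure_euclidean_open_hemisphere_ne_zero hk hu
    (measure_mono_null (fun x hx => hx.1) h)

theorem ae_norm_eq_one_sphereUniform (k : ℕ) : ∀ᵐ x ∂(sphereUniform k), ‖x‖ = 1 := by
  refine Measure.ae_smul_measure ?_ _
  filter_upwards [ae_restrict_mem Metric.isClosed_sphere.measurableSet] with x hx
  exact mem_sphere_zero_iff_norm.mp hx

theorem measurePreserving_neg_sphereUniform (k : ℕ) :
    MeasurePreserving (fun x : EuclideanSpace ℝ (Fin k) => -x)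
      (sphereUniform k) (sphereUniform k) := by
  have h := ((IsometryEquiv.neg (EuclideanSpace ℝ (Fin k))).measurePreserving_hausdorffMeasure
    ((k : ℝ) - 1)).restrict_preimage (Metric.isClosed_sphere (x := 0) (ε := 1)).measurableSet
  have hpre : (IsometryEquiv.neg (EuclideanSpace ℝ (Fin k))) ⁻¹' Metric.sphere 0 1 =
      Metric.sphere 0 1 := by
    ext x
    simp
  rw [hpre] at h
  exact h.smul_measure _

theorem sphereUniform_inner_pos (hk : 1 ≤ k) (hu : ‖u‖ = 1) :
    0 < sphereUniform k {x | 0 < ⟪x, u⟫} := by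
  have hmeas : MeasurableSet {x : EuclideanSpace ℝ (Fin k) | 0 < ⟪x, u⟫} :=
    (isOpen_lt continuous_const (by fun_prop)).measurableSet
  rw [sphereUniform, Measure.smul_apply, Measure.restrict_apply hmeas, smul_eq_mul]
  refine ENNReal.mul_pos (ENNReal.inv_ne_zero.mpr (hausdorffMeasure_euclidean_sphere_ne_top hk hu)) ?_
  convert hausdorffMeasure_euclidean_open_hemisphere_ne_zero hk hu using 2
  ext x
  simp [and_comm]

end SphereUniform

section PairAverage

variable {ι : Type*} [Fintype ι]

/-- Average of the entries `A i j` with respect to the square of the probability weights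
proportional to `exp (b * c * x i) * α i`. -/
def gibbsPairAvg (α : ι → ℝ) (b : ℝ) (x : ι → ℝ) (A : ι → ι → ℝ) (c : ℝ) : ℝ :=
  (∑ i, ∑ j, A i j * Real.exp (b * c * (x i + x j)) * α i * α j) /
    (∑ i, Real.exp (b * c * x i) * α i) ^ 2

/-- The derivative of `gibbsPairAvg` in the parameter `c`. -/
def gibbsPairAvgDeriv (α : ι → ℝ) (b : ℝ) (x : ι → ℝ) (A : ι → ι → ℝ) (c : ℝ) : ℝ :=
  ((∑ i, ∑ j, A i j * (Real.exp (b * c * (x i + x j)) * (b * (x i + x j))) * α i * α j) *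
        (∑ i, Real.exp (b * c * x i) * α i) ^ 2 -
      (∑ i, ∑ j, A i j * Real.exp (b * c * (x i + x j)) * α i * α j) *
        (2 * (∑ i, Real.exp (b * c * x i) * α i) *
          ∑ i, Real.exp (b * c * x i) * (b * x i) * α i)) /
    ((∑ i, Real.exp (b * c * x i) * α i) ^ 2) ^ 2

variable {α : ι → ℝ}

theorem gibbsPartition_pos [Nonempty ι] (hα : ∀ i, 0 < α i) (b : ℝ) (x : ι → ℝ) (c : ℝ) :
    0 < ∑ i, Real.exp (b * c * x i) * α i :=
  Finset.sum_pos (fun i _ => mul_pos (Real.exp_pos _) (hα i)) Finset.univ_nonempty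

theorem gibbsPartition_sq (b : ℝ) (x : ι → ℝ) (c : ℝ) :
    (∑ i, Real.exp (b * c * x i) * α i) ^ 2 =
      ∑ i, ∑ j, Real.exp (b * c * (x i + x j)) * α i * α j := by
  rw [sq, Finset.sum_mul_sum]
  refine Finset.sum_congr rfl fun i _ => Finset.sum_congr rfl fun j _ => ?_
  rw [mul_add, Real.exp_add]
  ring

theorem hasDerivAt_gibbsPairAvg [Nonempty ι] (hα : ∀ i, 0 < α i) (b : ℝ) (x : ι → ℝ)
    (A : ι → ι → ℝ) (c : ℝ) :
    HasDerivAt (gibbsPairAvg α b x A) (gibbsPairAvgDeriv α b x A c) c := by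
  have hexp : ∀ y : ℝ,
      HasDerivAt (fun c => Real.exp (b * c * y)) (Real.exp (b * c * y) * (b * y)) c := fun y => by
    have h := (((hasDerivAt_id c).const_mul b).mul_const y).exp
    simpa using h
  have hS : HasDerivAt (fun c => ∑ i, Real.exp (b * c * x i) * α i)
      (∑ i, Real.exp (b * c * x i) * (b * x i) * α i) c :=
    HasDerivAt.fun_sum fun i _ => (hexp (x i)).mul_const (α i)
  have hN : HasDerivAt (fun c => ∑ i, ∑ j, A i j * Real.exp (b * c * (x i + x j)) * α i * α j)
      (∑ i, ∑ j, A i j * (Real.exp (b * c * (x i + x j)) * (b * (x i + x j))) * α i * α j) c :=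
    HasDerivAt.fun_sum fun i _ => HasDerivAt.fun_sum fun j _ =>
      (((hexp (x i + x j)).const_mul (A i j)).mul_const (α i)).mul_const (α j)
  have h := hN.div (hS.fun_pow 2) (pow_ne_zero 2 (gibbsPartition_pos hα b x c).ne')
  refine HasDerivAt.congr_deriv (f := gibbsPairAvg α b x A) h ?_
  simp [gibbsPairAvgDeriv]

theorem abs_sum_mul_exp_le (hα : ∀ i, 0 < α i) {b C : ℝ} {x : ι → ℝ} {c : ℝ} {A : ι → ι → ℝ}
    (hA : ∀ i j, |A i j| ≤ C) :
    |∑ i, ∑ j, A i j * Real.exp (b * c * (x i + x j)) * α i * α j| ≤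
      C * (∑ i, Real.exp (b * c * x i) * α i) ^ 2 := by
  rw [gibbsPartition_sq, Finset.mul_sum]
  refine (Finset.abs_sum_le_sum_abs _ _).trans (Finset.sum_le_sum fun i _ => ?_)
  rw [Finset.mul_sum]
  refine (Finset.abs_sum_le_sum_abs _ _).trans (Finset.sum_le_sum fun j _ => ?_)
  rw [abs_mul, abs_mul, abs_mul, abs_of_pos (hα i), abs_of_pos (hα j), Real.abs_exp, ← mul_assoc,
    ← mul_assoc]
  have := hα i
  have := hα j
  gcongr
  exact hA i j

theorem abs_gibbsPairAvg_le [Nonempty ι] (hα : ∀ i, 0 < α i) {b C : ℝ} {x : ι → ℝ}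
    {A : ι → ι → ℝ} (hA : ∀ i j, |A i j| ≤ C) (c : ℝ) :
    |gibbsPairAvg α b x A c| ≤ C := by
  have hS := gibbsPartition_pos hα b x c
  rw [gibbsPairAvg, abs_div, abs_of_pos (pow_pos hS 2), div_le_iff₀ (pow_pos hS 2)]
  exact abs_sum_mul_exp_le hα hA

theorem abs_gibbsPairAvgDeriv_le [Nonempty ι] (hα : ∀ i, 0 < α i) {b C : ℝ} {x : ι → ℝ}
    {A : ι → ι → ℝ} (hx : ∀ i, |x i| ≤ 1) (hA : ∀ i j, |A i j| ≤ C) (c : ℝ) :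
    |gibbsPairAvgDeriv α b x A c| ≤ 4 * |b| * C := by
  have hS := gibbsPartition_pos hα b x c
  have hC : 0 ≤ C := (abs_nonneg _).trans (hA (Classical.arbitrary ι) (Classical.arbitrary ι))
  have hN := abs_sum_mul_exp_le (b := b) (x := x) (c := c) hα hA
  have hN' : |∑ i, ∑ j, A i j * (Real.exp (b * c * (x i + x j)) * (b * (x i + x j))) * α i * α j| ≤
      2 * |b| * C * (∑ i, Real.exp (b * c * x i) * α i) ^ 2 := by
    have h := abs_sum_mul_exp_le (b := b) (x := x) (c := c) (C := 2 * |b| * C)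
      (A := fun i j => A i j * (b * (x i + x j))) hα fun i j => by
        have h2 : |x i + x j| ≤ 2 := (abs_add_le _ _).trans (by linarith [hx i, hx j])
        rw [abs_mul, abs_mul]
        calc |A i j| * (|b| * |x i + x j|) ≤ C * (|b| * 2) := by gcongr; exact hA i j
          _ = 2 * |b| * C := by ring
    refine le_of_eq_of_le ?_ h
    congr 1
    refine Finset.sum_congr rfl fun i _ => Finset.sum_congr rfl fun j _ => ?_
    ring
  have hS' : |∑ i, Real.exp (b * c * x i) * (b * x i) * α i| ≤
      |b| * ∑ i, Real.exp (b * c * x i) * α i := by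
    rw [Finset.mul_sum]
    refine (Finset.abs_sum_le_sum_abs _ _).trans (Finset.sum_le_sum fun i _ => ?_)
    rw [abs_mul, abs_mul, abs_mul, abs_of_pos (hα i), Real.abs_exp]
    have := hα i
    calc Real.exp (b * c * x i) * (|b| * |x i|) * α i
        ≤ Real.exp (b * c * x i) * (|b| * 1) * α i := by gcongr; exact hx i
      _ = |b| * (Real.exp (b * c * x i) * α i) := by ring
  rw [gibbsPairAvgDeriv, abs_div, abs_of_pos (pow_pos (pow_pos hS 2) 2),
    div_le_iff₀ (pow_pos (pow_pos hS 2) 2)]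
  set S := ∑ i, Real.exp (b * c * x i) * α i
  set S' := ∑ i, Real.exp (b * c * x i) * (b * x i) * α i
  refine (abs_sub _ _).trans ?_
  rw [abs_mul, abs_mul, abs_mul, abs_mul, abs_of_pos (pow_pos hS 2), abs_of_pos hS, abs_two]
  calc _ ≤ 2 * |b| * C * S ^ 2 * S ^ 2 + C * S ^ 2 * (2 * S * (|b| * S)) := by gcongr
    _ = 4 * |b| * C * (S ^ 2) ^ 2 := by ring

theorem gibbsPairAvgDeriv_neg_left (b : ℝ) (x : ι → ℝ) (A : ι → ι → ℝ) :
    gibbsPairAvgDeriv α b (-x) A 0 = -gibbsPairAvgDeriv α b x A 0 := by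
  simp only [gibbsPairAvgDeriv, Pi.neg_apply, mul_zero, zero_mul, Real.exp_zero, one_mul, mul_one]
  rw [← neg_div]
  congr 1
  have h1 : ∑ i, ∑ j, A i j * (b * (-x i + -x j)) * α i * α j =
      -∑ i, ∑ j, A i j * (b * (x i + x j)) * α i * α j := by
    simp only [← Finset.sum_neg_distrib]
    refine Finset.sum_congr rfl fun i _ => Finset.sum_congr rfl fun j _ => ?_
    ring
  have h2 : ∑ i, b * -x i * α i = -∑ i, b * x i * α i := by
    simp only [← Finset.sum_neg_distrib]
    refine Finset.sum_congr rfl fun i _ => ?_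
    ring
  rw [h1, h2]
  ring

theorem gibbsPairAvgDeriv_sub (b : ℝ) (x : ι → ℝ) (A B : ι → ι → ℝ) (c : ℝ) :
    gibbsPairAvgDeriv α b x (A - B) c =
      gibbsPairAvgDeriv α b x A c - gibbsPairAvgDeriv α b x B c := by
  simp only [gibbsPairAvgDeriv, Pi.sub_apply, sub_mul, Finset.sum_sub_distrib]
  ring

theorem gibbsPairAvgDeriv_add_self [Nonempty ι] (hα : ∀ i, 0 < α i) (b : ℝ) (x : ι → ℝ) :
    gibbsPairAvgDeriv α b x (fun i j => x i + x j) 0 =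
      b / (∑ i, α i) ^ 2 * ∑ i, ∑ j, α i * α j * (x i - x j) ^ 2 := by
  have hs : 0 < ∑ i, α i := Finset.sum_pos (fun i _ => hα i) Finset.univ_nonempty
  simp only [gibbsPairAvgDeriv, mul_zero, zero_mul, Real.exp_zero, one_mul, mul_one]
  set s := ∑ i, α i with hsdef
  set X := ∑ i, α i * x i with hX
  set Q := ∑ i, α i * x i ^ 2 with hQ
  have h1 : ∑ i, ∑ j, (x i + x j) * (b * (x i + x j)) * α i * α j =
      b * (2 * (s * Q) + 2 * (X * X)) := by
    have : ∀ i j, (x i + x j) * (b * (x i + x j)) * α i * α j =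
        b * ((α i * x i ^ 2) * α j) + b * (α i * (α j * x j ^ 2)) +
          2 * b * ((α i * x i) * (α j * x j)) := fun i j => by ring
    simp only [this, Finset.sum_add_distrib, ← Finset.mul_sum]
    simp only [← Finset.sum_mul, ← hsdef, ← hX, ← hQ]
    ring
  have h2 : ∑ i, ∑ j, (x i + x j) * α i * α j = 2 * (s * X) := by
    have : ∀ i j, (x i + x j) * α i * α j = (α i * x i) * α j + α i * (α j * x j) :=
      fun i j => by ring
    simp only [this, Finset.sum_add_distrib, ← Finset.mul_sum]
    simp only [← Finset.sum_mul, ← hsdef, ← hX]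
    ring
  have h3 : ∑ i, b * x i * α i = b * X := by
    rw [hX, Finset.mul_sum]
    exact Finset.sum_congr rfl fun i _ => by ring
  have h4 : ∑ i, ∑ j, α i * α j * (x i - x j) ^ 2 = 2 * (s * Q) - 2 * (X * X) := by
    have : ∀ i j, α i * α j * (x i - x j) ^ 2 =
        (α i * x i ^ 2) * α j + α i * (α j * x j ^ 2) - 2 * ((α i * x i) * (α j * x j)) :=
      fun i j => by ring
    simp only [this, Finset.sum_add_distrib, Finset.sum_sub_distrib, ← Finset.mul_sum]
    simp only [← Finset.sum_mul, ← hsdef, ← hX, ← hQ]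
    ring
  rw [h1, h2, h3, h4]
  field_simp
  ring

variable {Ω : Type*} [MeasurableSpace Ω] {x : Ω → ι → ℝ} {A : Ω → ι → ι → ℝ}

theorem hasDerivAt_integral_gibbsPairAvg [Nonempty ι] (hα : ∀ i, 0 < α i) (b : ℝ) {C : ℝ}
    (P : Measure Ω) [IsFiniteMeasure P]
    (hx : ∀ i, Measurable fun ω => x ω i) (hA : ∀ i j, Measurable fun ω => A ω i j)
    (hx1 : ∀ᵐ ω ∂P, ∀ i, |x ω i| ≤ 1) (hAC : ∀ᵐ ω ∂P, ∀ i j, |A ω i j| ≤ C) :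
    Integrable (fun ω => gibbsPairAvgDeriv α b (x ω) (A ω) 0) P ∧
      HasDerivAt (fun c => ∫ ω, gibbsPairAvg α b (x ω) (A ω) c ∂P)
        (∫ ω, gibbsPairAvgDeriv α b (x ω) (A ω) 0 ∂P) 0 := by
  have hmeas : ∀ c, Measurable fun ω => gibbsPairAvg α b (x ω) (A ω) c := fun c => by
    unfold gibbsPairAvg
    fun_prop
  refine hasDerivAt_integral_of_dominated_loc_of_deriv_le (μ := P) (x₀ := 0) (bound := fun _ => 4 * |b| * C)
    (F' := fun c ω => gibbsPairAvgDeriv α b (x ω) (A ω) c)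
    Filter.univ_mem (Filter.Eventually.of_forall fun c => (hmeas c).aestronglyMeasurable) ?_ ?_ ?_
    (integrable_const _) ?_
  · refine Integrable.of_bound (hmeas 0).aestronglyMeasurable C ?_
    filter_upwards [hAC] with ω hω
    exact abs_gibbsPairAvg_le hα hω 0
  · refine Measurable.aestronglyMeasurable ?_
    unfold gibbsPairAvgDeriv
    fun_prop
  · filter_upwards [hx1, hAC] with ω hω hω' c _
    exact abs_gibbsPairAvgDeriv_le hα hω hω' c
  · exact Filter.Eventually.of_forall fun ω c _ => hasDerivAt_gibbsPairAvg hα b (x ω) (A ω) c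

end PairAverage

section Derivative

variable {k n : ℕ} {u : EuclideanSpace ℝ (Fin k)}

theorem Jloss_eq_gibbsPairAvg (α : Fin n → ℝ) (ca cu σ c : ℝ) :
    Jloss k n u α ca cu σ c =
      ca ^ 2 * cu ^ 2 * ∫ us : Fin n → EuclideanSpace ℝ (Fin k),
          gibbsPairAvg α (cu ^ 2) (fun i => ⟪us i, u⟫) (fun i j => ⟪us i - u, us j - u⟫) c
          ∂(Measure.pi fun _ : Fin n => sphereUniform k) +
        σ ^ 2 * ∫ us : Fin n → EuclideanSpace ℝ (Fin k),
          gibbsPairAvg α (cu ^ 2) (fun i => ⟪us i, u⟫) (fun i j => if i = j then 1 else 0) c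
          ∂(Measure.pi fun _ : Fin n => sphereUniform k) := by
  rw [Jloss]
  congr 3
  · simp only [gibbsPairAvg, inner_add_left]
  · funext us
    rw [gibbsPairAvg]
    congr 1
    refine Finset.sum_congr rfl fun i _ => ?_
    simp only [ite_mul, one_mul, zero_mul, Finset.sum_ite_eq, Finset.mem_univ, if_true]
    rw [mul_assoc _ (α i) (α i), ← sq, show cu ^ 2 * c * (⟪us i, u⟫ + ⟪us i, u⟫) = 2 * cu ^ 2 * c * ⟪us i, u⟫ by ring]

/-- The derivative at `0` of an average with even entries is an odd function of the sample. -/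
theorem integral_gibbsPairAvgDeriv_eq_zero (hk : 1 ≤ k) (hu : ‖u‖ = 1) (α : Fin n → ℝ) (b : ℝ)
    {A : (Fin n → EuclideanSpace ℝ (Fin k)) → Fin n → Fin n → ℝ} (hA : ∀ us, A (-us) = A us) :
    ∫ us : Fin n → EuclideanSpace ℝ (Fin k), gibbsPairAvgDeriv α b (fun i => ⟪us i, u⟫) (A us) 0
      ∂(Measure.pi fun _ : Fin n => sphereUniform k) = 0 := by
  have := isProbabilityMeasure_sphereUniform hk hu
  have hneg : MeasurePreserving (MeasurableEquiv.neg (Fin n → EuclideanSpace ℝ (Fin k)))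
      (Measure.pi fun _ : Fin n => sphereUniform k) (Measure.pi fun _ : Fin n => sphereUniform k) :=
    measurePreserving_pi _ _ fun _ => measurePreserving_neg_sphereUniform k
  have h := hneg.integral_comp' fun us => gibbsPairAvgDeriv α b (fun i => ⟪us i, u⟫) (A us) 0
  have hodd : ∀ us : Fin n → EuclideanSpace ℝ (Fin k),
      gibbsPairAvgDeriv α b (fun i => ⟪(-us) i, u⟫) (A (-us)) 0 =
        -gibbsPairAvgDeriv α b (fun i => ⟪us i, u⟫) (A us) 0 := fun us => by
    rw [hA, ← gibbsPairAvgDeriv_neg_left]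
    congr 1
    funext i
    simp
  simp only [MeasurableEquiv.neg_apply, hodd, integral_neg] at h
  linarith

theorem pi_sphereUniform_inner_ne_pos (hk : 1 ≤ k) (hu : ‖u‖ = 1) {p q : Fin n} (hpq : p ≠ q) :
    0 < Measure.pi (fun _ : Fin n => sphereUniform k)
      {us : Fin n → EuclideanSpace ℝ (Fin k) | ⟪us p, u⟫ ≠ ⟪us q, u⟫} := by
  have := isProbabilityMeasure_sphereUniform hk hu
  set s : Fin n → Set (EuclideanSpace ℝ (Fin k)) :=
    fun i => if i = p then {x | 0 < ⟪x, u⟫} else {x | 0 < ⟪x, -u⟫}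
  have hs : 0 < Measure.pi (fun _ : Fin n => sphereUniform k) (Set.univ.pi s) := by
    rw [Measure.pi_pi, CanonicallyOrderedAdd.prod_pos]
    intro i _
    by_cases hi : i = p
    · simpa [s, hi] using sphereUniform_inner_pos hk hu
    · simpa [s, hi] using sphereUniform_inner_pos (u := -u) hk (by rwa [norm_neg])
  refine hs.trans_le (measure_mono fun us hus => ?_)
  have hp : 0 < ⟪us p, u⟫ := by simpa [s] using hus p (Set.mem_univ p)
  have hq : ⟪us q, u⟫ < 0 := by simpa [s, hpq.symm] using hus q (Set.mem_univ q)
  exact (hq.trans hp).ne'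

theorem ae_norm_eq_one_pi_sphereUniform (hk : 1 ≤ k) (hu : ‖u‖ = 1) :
    ∀ᵐ us ∂(Measure.pi fun _ : Fin n => sphereUniform k), ∀ i, ‖us i‖ = 1 := by
  have := isProbabilityMeasure_sphereUniform hk hu
  exact Measure.ae_pi_le_pi (Filter.eventually_pi fun i => ae_norm_eq_one_sphereUniform k)

theorem integral_gibbsPairAvgDeriv_inner_add_pos (hk : 1 ≤ k) (hn : 2 ≤ n) (hu : ‖u‖ = 1)
    {α : Fin n → ℝ} (hα : ∀ i, 0 < α i) {b : ℝ} (hb : 0 < b)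
    (hint : Integrable (fun us : Fin n → EuclideanSpace ℝ (Fin k) =>
      gibbsPairAvgDeriv α b (fun i => ⟪us i, u⟫) (fun i j => ⟪us i, u⟫ + ⟪us j, u⟫) 0)
      (Measure.pi fun _ : Fin n => sphereUniform k)) :
    0 < ∫ us : Fin n → EuclideanSpace ℝ (Fin k),
      gibbsPairAvgDeriv α b (fun i => ⟪us i, u⟫) (fun i j => ⟪us i, u⟫ + ⟪us j, u⟫) 0
      ∂(Measure.pi fun _ : Fin n => sphereUniform k) := by
  have : Nonempty (Fin n) := ⟨⟨0, by omega⟩⟩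
  have hs : 0 < ∑ i, α i := Finset.sum_pos (fun i _ => hα i) Finset.univ_nonempty
  have hterm : ∀ (us : Fin n → EuclideanSpace ℝ (Fin k)) (i j : Fin n),
      0 ≤ α i * α j * (⟪us i, u⟫ - ⟪us j, u⟫) ^ 2 := fun us i j =>
    mul_nonneg (mul_pos (hα i) (hα j)).le (sq_nonneg _)
  rw [integral_pos_iff_support_of_nonneg _ hint]
  · refine (pi_sphereUniform_inner_ne_pos hk hu
      (show (⟨0, by omega⟩ : Fin n) ≠ ⟨1, by omega⟩ by simp)).trans_le (measure_mono fun us hus => ?_)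
    rw [Function.mem_support, gibbsPairAvgDeriv_add_self hα]
    refine (mul_pos (by positivity) ?_).ne'
    refine Finset.sum_pos' (fun i _ => Finset.sum_nonneg fun j _ => hterm us i j)
      ⟨⟨0, by omega⟩, Finset.mem_univ _,
        Finset.sum_pos' (fun j _ => hterm us _ j) ⟨⟨1, by omega⟩, Finset.mem_univ _, ?_⟩⟩
    exact mul_pos (mul_pos (hα _) (hα _)) (sq_pos_of_ne_zero (sub_ne_zero.mpr hus))
  · intro us
    simp only [Pi.zero_apply, gibbsPairAvgDeriv_add_self hα]
    exact mul_nonneg (by positivity)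
      (Finset.sum_nonneg fun i _ => Finset.sum_nonneg fun j _ => hterm us i j)

theorem exists_hasDerivAt_Jloss_neg (hk : 1 ≤ k) (hn : 2 ≤ n) (hu : ‖u‖ = 1)
    {α : Fin n → ℝ} (hα : ∀ i, 0 < α i) {ca cu : ℝ} (hca : ca ≠ 0) (hcu : cu ≠ 0) (σ : ℝ) :
    ∃ d < 0, HasDerivAt (Jloss k n u α ca cu σ) d 0 := by
  have := isProbabilityMeasure_sphereUniform hk hu
  have : Nonempty (Fin n) := ⟨⟨0, by omega⟩⟩
  have hnorm := ae_norm_eq_one_pi_sphereUniform (n := n) hk hu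
  have hx1 : ∀ᵐ us ∂(Measure.pi fun _ : Fin n => sphereUniform k), ∀ i, |⟪us i, u⟫| ≤ 1 := by
    filter_upwards [hnorm] with us hus i
    simpa [hus i, hu] using abs_real_inner_le_norm (us i) u
  have hcross : ∀ᵐ us ∂(Measure.pi fun _ : Fin n => sphereUniform k),
      ∀ i j, |⟪us i, us j⟫ + 1| ≤ 2 := by
    filter_upwards [hnorm] with us hus i j
    have h : |⟪us i, us j⟫| ≤ 1 := by
      simpa [hus i, hus j] using abs_real_inner_le_norm (us i) (us j)
    rw [abs_le] at h ⊢
    constructor <;> linarith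
  have hadd : ∀ᵐ us ∂(Measure.pi fun _ : Fin n => sphereUniform k),
      ∀ i j, |⟪us i, u⟫ + ⟪us j, u⟫| ≤ 2 := by
    filter_upwards [hx1] with us hus i j
    exact (abs_add_le _ _).trans (by linarith [hus i, hus j])
  have hsplit : ∀ us : Fin n → EuclideanSpace ℝ (Fin k),
      (fun i j => ⟪us i - u, us j - u⟫) =
        (fun i j => ⟪us i, us j⟫ + 1) - fun i j => ⟪us i, u⟫ + ⟪us j, u⟫ := fun us => by
    funext i j
    rw [Pi.sub_apply, Pi.sub_apply, inner_sub_left, inner_sub_right, inner_sub_right,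
      real_inner_self_eq_norm_sq, hu, real_inner_comm (us j) u]
    ring
  have hsignal : ∀ᵐ us ∂(Measure.pi fun _ : Fin n => sphereUniform k),
      ∀ i j, |⟪us i - u, us j - u⟫| ≤ 4 := by
    filter_upwards [hcross, hadd] with us h h' i j
    rw [congrFun (congrFun (hsplit us) i) j]
    exact (abs_sub _ _).trans (by linarith [h i j, h' i j])
  have hxm : ∀ i, Measurable fun us : Fin n → EuclideanSpace ℝ (Fin k) => ⟪us i, u⟫ := fun i =>
    Continuous.measurable (by fun_prop)
  obtain ⟨-, hderiv⟩ := hasDerivAt_integral_gibbsPairAvg hα (cu ^ 2) _ hxm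
    (fun i j => Continuous.measurable (by fun_prop)) hx1 hsignal
  obtain ⟨-, hderiv'⟩ := hasDerivAt_integral_gibbsPairAvg hα (cu ^ 2) (C := 1) _ hxm
    (A := fun _ i j => if i = j then 1 else 0) (fun i j => measurable_const) hx1
    (Filter.Eventually.of_forall fun us i j => by split_ifs <;> simp)
  obtain ⟨hint, -⟩ := hasDerivAt_integral_gibbsPairAvg hα (cu ^ 2) _ hxm
    (fun i j => Continuous.measurable (by fun_prop)) hx1 hcross
  obtain ⟨hint', -⟩ := hasDerivAt_integral_gibbsPairAvg hα (cu ^ 2) _ hxm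
    (fun i j => Continuous.measurable (by fun_prop)) hx1 hadd
  have hpos := integral_gibbsPairAvgDeriv_inner_add_pos hk hn hu hα (by positivity) hint'
  have hzero := integral_gibbsPairAvgDeriv_eq_zero hk hu α (cu ^ 2)
    (A := fun us i j => ⟪us i, us j⟫ + 1) fun us => by simp
  have hzero' := integral_gibbsPairAvgDeriv_eq_zero hk hu α (cu ^ 2)
    (A := fun _ i j => if i = j then 1 else 0) fun us => rfl
  simp only [hsplit, gibbsPairAvgDeriv_sub] at hderiv
  rw [integral_sub hint hint', hzero, zero_sub] at hderiv
  rw [hzero'] at hderiv'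
  have h := (hderiv.const_mul (ca ^ 2 * cu ^ 2)).add (hderiv'.const_mul (σ ^ 2))
  refine ⟨_, ?_, HasDerivAt.congr_of_eventuallyEq h
    (Filter.Eventually.of_forall fun c => ?_)⟩
  · rw [mul_zero, add_zero, mul_neg, neg_lt_zero]
    exact mul_pos (by positivity) hpos
  · rw [Jloss_eq_gibbsPairAvg]
    simp only [hsplit]
    rfl

end Derivative

/-- Lemma 8: `c = 0` is not a minimizer of `J` over `[0, δ]`, for any `δ > 0`. -/
theorem zero_not_minimizer_of_J (k n : ℕ) (hk : 1 ≤ k) (hn : 2 ≤ n)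
    (u : EuclideanSpace ℝ (Fin k)) (hu : ‖u‖ = 1)
    (α : Fin n → ℝ) (hα : ∀ i, 0 < α i)
    (ca cu σ : ℝ) (hca : ca ≠ 0) (hcu : cu ≠ 0) (hσ : 0 ≤ σ) :
    ∀ δ : ℝ, 0 < δ →
      ∃ c : ℝ, 0 < c ∧ c ≤ δ ∧ Jloss k n u α ca cu σ c < Jloss k n u α ca cu σ 0 := by
  intro δ hδ
  obtain ⟨d, hd, h⟩ := exists_hasDerivAt_Jloss_neg hk hn hu hα hca hcu σ
  have hslope := (h.tendsto_slope.mono_left (nhdsGT_le_nhdsNE 0)).eventually_lt_const hd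
  obtain ⟨c, hc, hc0, hcδ⟩ := (hslope.and (Ioc_mem_nhdsGT hδ)).exists
  refine ⟨c, hc0, hcδ, ?_⟩
  rw [slope_def_field, sub_zero] at hc
  linarith [(div_lt_iff₀ hc0).mp hc]
end
end

section
/- Let k ≥ 1, n ≥ 2, u ∈ S^{k−1}, c ∈ (0, 2], and α = (α_1,…,α_n) ∈ ℝ^n with α_1 = max_i α_i, min_i α_i > 0, and α_1 > min_i α_i. With u_1,…,u_n i.i.d. uniform on S^{k−1}, define H_signal(α) := E[ Σ_{i=1}^n Σ_{j=1}^n (u_i − u)^⊤(u_j − u)·e^{c·u_i^⊤ u + c·u_j^⊤ u}·α_i·α_j / ( Σ_{i=1}^n e^{c·u_i^⊤ u}·α_i )² ]. Then the partial derivative of H_signal with respect to α_1, evaluated at the given α, is strictly positive. -/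
open MeasureTheory Real
open scoped RealInnerProductSpace

noncomputable section

/-- The signal term `H_signal(α)` of Lemma 9, with the expectation over
`u_1, …, u_n` i.i.d. uniform on `S^{k-1}`. -/
def Hsignal (k n : ℕ) (u : EuclideanSpace ℝ (Fin k)) (c : ℝ) (α : Fin n → ℝ) : ℝ :=
  ∫ us : Fin n → EuclideanSpace ℝ (Fin k),
    (∑ i : Fin n, ∑ j : Fin n,
        ⟪us i - u, us j - u⟫ * Real.exp (c * ⟪us i, u⟫ + c * ⟪us j, u⟫) * α i * α j) /
      (∑ i : Fin n, Real.exp (c * ⟪us i, u⟫) * α i) ^ 2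
    ∂(Measure.pi fun _ : Fin n => sphereUniform k)

/-- The `n`-dimensional Hausdorff measure of the unit sphere of `ℝ^{n+1}` is positive. -/
lemma hausdorffMeasure_sphere_pos (n : ℕ) :
    0 < μH[(n : ℝ)] (Metric.sphere (0 : EuclideanSpace ℝ (Fin (n + 1))) 1) := by
  set p : EuclideanSpace ℝ (Fin (n + 1)) → (Fin n → ℝ) := fun x i => x i.succ with hp
  have hlip : LipschitzWith 1 p := by
    refine LipschitzWith.of_dist_le_mul fun x y => ?_
    rw [NNReal.coe_one, one_mul, dist_pi_le_iff dist_nonneg]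
    intro i
    rw [EuclideanSpace.dist_eq]
    refine Real.le_sqrt_of_sq_le ?_
    exact Finset.single_le_sum (f := fun j => dist (x j) (y j) ^ 2)
      (fun j _ => sq_nonneg _) (Finset.mem_univ i.succ)
  have hsub : Metric.ball (0 : Fin n → ℝ) (1 / (n + 1)) ⊆
      p '' Metric.sphere (0 : EuclideanSpace ℝ (Fin (n + 1))) 1 := by
    intro z hz
    rw [mem_ball_zero_iff] at hz
    have hzi : ∀ i, z i ^ 2 ≤ 1 / (n + 1) := fun i => by
      have h1 : |z i| ≤ 1 / (n + 1) := (norm_le_pi_norm z i).trans hz.le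
      have h2 : (1 : ℝ) / (n + 1) ≤ 1 := by
        rw [div_le_one (by positivity)]; linarith [n.cast_nonneg (α := ℝ)]
      rw [← sq_abs]
      nlinarith [abs_nonneg (z i)]
    have hsum : ∑ i, z i ^ 2 ≤ 1 := by
      calc ∑ i, z i ^ 2 ≤ ∑ _i : Fin n, (1 : ℝ) / (n + 1) := Finset.sum_le_sum fun i _ => hzi i
        _ = n / (n + 1) := by simp [div_eq_mul_inv]
        _ ≤ 1 := by rw [div_le_one (by positivity)]; linarith
    refine ⟨WithLp.toLp 2 (Fin.cons (√(1 - ∑ i, z i ^ 2)) z), ?_, ?_⟩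
    · rw [mem_sphere_zero_iff_norm, EuclideanSpace.norm_eq, Fin.sum_univ_succ]
      simp [Real.sq_sqrt (sub_nonneg.2 hsum)]
    · ext i; simp [hp]
  have hball : 0 < μH[(n : ℝ)] (Metric.ball (0 : Fin n → ℝ) (1 / (n + 1))) := by
    have h := hausdorffMeasure_pi_real (ι := Fin n)
    rw [Fintype.card_fin] at h
    rw [h]
    exact Metric.measure_ball_pos _ _ (by positivity)
  refine hball.trans_le ((measure_mono hsub).trans ?_)
  simpa using hlip.hausdorffMeasure_image_le (d := (n : ℝ)) n.cast_nonneg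
    (Metric.sphere (0 : EuclideanSpace ℝ (Fin (n + 1))) 1)

/-- The `n`-dimensional Hausdorff measure of the unit sphere of `ℝ^{n+1}` is finite. -/
lemma hausdorffMeasure_sphere_lt_top_s8 (n : ℕ) :
    μH[(n : ℝ)] (Metric.sphere (0 : EuclideanSpace ℝ (Fin (n + 1))) 1) < ⊤ := by
  set Q : Set (Fin n → ℝ) := Metric.closedBall 0 1 with hQ
  set g : Fin (n + 1) → ℝ → (Fin n → ℝ) → EuclideanSpace ℝ (Fin (n + 1)) :=
    fun i s z => WithLp.toLp 2 (i.insertNth s z) with hg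
  have hgi : ∀ i s z, g i s z i = s := fun i s z => by simp [hg]
  have hg0 : ∀ i s z, s ≠ 0 → g i s z ≠ 0 := fun i s z hs h => hs <| by
    rw [← hgi i s z, h]; rfl
  have hgd : ∀ i s, ContDiff ℝ 1 (g i s) := fun i s => by
    rw [contDiff_euclidean]
    intro j
    refine Fin.succAboveCases i ?_ (fun j => ?_) j
    · simpa [hg] using contDiff_const
    · simpa [hg] using contDiff_apply ℝ ℝ j
  have hfin : ∀ i s, s ≠ 0 → μH[(n : ℝ)] ((fun z => ‖g i s z‖⁻¹ • g i s z) '' Q) < ⊤ := by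
    intro i s hs
    have hd : ContDiff ℝ 1 (fun z => ‖g i s z‖⁻¹ • g i s z) :=
      (((hgd i s).norm ℝ fun z => hg0 i s z hs).inv
        fun z => norm_ne_zero_iff.2 (hg0 i s z hs)).smul (hgd i s)
    obtain ⟨K, hK⟩ := hd.contDiffOn.exists_lipschitzOnWith (s := Q) one_ne_zero
      (convex_closedBall _ _) (isCompact_closedBall _ _)
    refine (hK.hausdorffMeasure_image_le n.cast_nonneg).trans_lt ?_
    have h := hausdorffMeasure_pi_real (ι := Fin n)
    rw [Fintype.card_fin] at h
    rw [h]
    exact ENNReal.mul_lt_top (by simp) (isCompact_closedBall _ _).measure_lt_top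
  have hcov : Metric.sphere (0 : EuclideanSpace ℝ (Fin (n + 1))) 1 ⊆
      ⋃ i, (((fun z => ‖g i 1 z‖⁻¹ • g i 1 z) '' Q) ∪
        ((fun z => ‖g i (-1) z‖⁻¹ • g i (-1) z) '' Q)) := by
    intro x hx
    rw [mem_sphere_zero_iff_norm] at hx
    obtain ⟨i, hi⟩ := Finite.exists_max fun i => |x i|
    have hxi : 0 < |x i| := by
      rw [abs_pos]
      intro h0
      have : x = 0 := by
        ext j
        have := hi j
        simpa [h0] using this
      simp [this] at hx
    have key : ∀ s : ℝ, x i = s * |x i| → x ∈ (fun z => ‖g i s z‖⁻¹ • g i s z) '' Q := by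
      intro s hs
      refine ⟨fun j => |x i|⁻¹ * x (i.succAbove j), ?_, ?_⟩
      · rw [hQ, mem_closedBall_zero_iff, pi_norm_le_iff_of_nonneg zero_le_one]
        intro j
        rw [norm_mul, norm_inv, Real.norm_eq_abs, Real.norm_eq_abs, abs_abs,
          inv_mul_le_iff₀ hxi, mul_one]
        exact hi _
      · have hgx : g i s (fun j => |x i|⁻¹ * x (i.succAbove j)) = |x i|⁻¹ • x := by
          ext j
          refine Fin.succAboveCases i ?_ (fun j => ?_) j
          · simp only [hg, Fin.insertNth_apply_same, PiLp.smul_apply, smul_eq_mul]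
            field_simp
            linarith
          · simp [hg]
        simp only [hgx]
        rw [norm_smul, hx, norm_inv, Real.norm_eq_abs, abs_abs, mul_one, inv_inv, smul_smul,
          mul_inv_cancel₀ hxi.ne', one_smul]
    refine Set.mem_iUnion.2 ⟨i, ?_⟩
    rcases le_total 0 (x i) with h | h
    · exact Or.inl (key 1 (by rw [abs_of_nonneg h, one_mul]))
    · exact Or.inr (key (-1) (by rw [abs_of_nonpos h]; ring))
  refine (measure_mono hcov).trans_lt ((measure_iUnion_fintype_le _ _).trans_lt ?_)
  refine ENNReal.sum_lt_top.2 fun i _ => (measure_union_le _ _).trans_lt ?_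
  exact ENNReal.add_lt_top.2 ⟨hfin i 1 one_ne_zero, hfin i (-1) (by norm_num)⟩

lemma isProbabilityMeasure_sphereUniform_s8 (n : ℕ) :
    IsProbabilityMeasure (sphereUniform (n + 1)) := by
  constructor
  have h : ((n + 1 : ℕ) : ℝ) - 1 = n := by push_cast; ring
  rw [sphereUniform, Measure.smul_apply, Measure.restrict_apply_univ, h, smul_eq_mul]
  exact ENNReal.inv_mul_cancel (hausdorffMeasure_sphere_pos n).ne'
    (hausdorffMeasure_sphere_lt_top_s8 n).ne

lemma ae_sphereUniform_norm_eq_one (k : ℕ) : ∀ᵐ x ∂sphereUniform k, ‖x‖ = 1 := by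
  refine Measure.ae_smul_measure ?_ _
  filter_upwards [ae_restrict_mem Metric.isClosed_sphere.measurableSet] with x hx
  exact mem_sphere_zero_iff_norm.1 hx

lemma measurePreserving_sphereUniform (k : ℕ)
    (ρ : EuclideanSpace ℝ (Fin k) ≃ₗᵢ[ℝ] EuclideanSpace ℝ (Fin k)) :
    MeasurePreserving ρ (sphereUniform k) (sphereUniform k) := by
  refine MeasurePreserving.smul_measure ?_ _
  have h := (ρ.toIsometryEquiv.measurePreserving_hausdorffMeasure ((k : ℝ) - 1)).restrict_preimage
    (s := Metric.sphere 0 1) Metric.isClosed_sphere.measurableSet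
  have hs : (ρ.toIsometryEquiv : EuclideanSpace ℝ (Fin k) → EuclideanSpace ℝ (Fin k)) ⁻¹'
      Metric.sphere 0 1 = Metric.sphere 0 1 := by
    ext x; simp
  rw [hs] at h
  exact h

/-- For `0 ≤ c ≤ 2` the function `x ↦ e^{cx} (1 - x) / (1 + x)` is antitone on `(-1, 1]`;
here with the denominators cleared. -/
lemma exp_mul_one_sub_mul_one_add_le {c s t : ℝ} (hc2 : c ≤ 2) (hs : s ≤ 1)
    (ht : -1 ≤ t) (hts : t ≤ s) :
    exp (c * s) * ((1 - s) * (1 + t)) ≤ exp (c * t) * ((1 - t) * (1 + s)) := by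
  rcases ht.eq_or_lt with rfl | ht
  · have : 0 ≤ exp (c * -1) * ((1 - -1) * (1 + s)) :=
      mul_nonneg (exp_pos _).le (mul_nonneg (by norm_num) (by linarith))
    simpa using this
  have hderiv : ∀ x ∈ Set.Ioi (-1 : ℝ), HasDerivAt (fun x => exp (c * x) * ((1 - x) / (1 + x)))
      (exp (c * x) * ((c * (1 - x ^ 2) - 2) / (1 + x) ^ 2)) x := by
    intro x hx
    have hx' : 1 + x ≠ 0 := by have := Set.mem_Ioi.1 hx; linarith
    have h1 : HasDerivAt (fun x => exp (c * x)) (exp (c * x) * c) x := by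
      simpa using ((hasDerivAt_id x).const_mul c).exp
    have h2 := ((hasDerivAt_id x).const_sub 1).div ((hasDerivAt_id x).const_add 1) hx'
    refine (h1.mul h2).congr_deriv ?_
    simp only [id, Pi.div_apply]
    field_simp
    ring
  have hanti : AntitoneOn (fun x => exp (c * x) * ((1 - x) / (1 + x))) (Set.Icc t 1) := by
    refine antitoneOn_of_deriv_nonpos (convex_Icc _ _)
      (fun x hx => (hderiv x (ht.trans_le hx.1)).continuousAt.continuousWithinAt) ?_ ?_
    · intro x hx
      rw [interior_Icc] at hx
      exact (hderiv x (ht.trans hx.1)).differentiableAt.differentiableWithinAt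
    · intro x hx
      rw [interior_Icc] at hx
      have hx1 : -1 < x := ht.trans hx.1
      rw [(hderiv x hx1).deriv]
      refine mul_nonpos_of_nonneg_of_nonpos (exp_pos _).le
        (div_nonpos_of_nonpos_of_nonneg ?_ (sq_nonneg _))
      nlinarith [hx.2, mul_nonneg (by linarith : (0 : ℝ) ≤ 2 - c)
        (mul_nonneg (by linarith : (0 : ℝ) ≤ 1 + x) (by linarith [hx.2] : (0 : ℝ) ≤ 1 - x)),
        sq_nonneg x]
  have h := hanti ⟨le_rfl, hts.trans hs⟩ ⟨hts, hs⟩ hts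
  have hs0 : 0 < 1 + s := by linarith
  have ht0 : 0 < 1 + t := by linarith
  simp only [← mul_div_assoc] at h
  rw [div_le_div_iff₀ hs0 ht0] at h
  linarith

/-- The symmetrised pair term, for the larger projection `s` and the smaller one `t`. -/
lemma pair_term_nonneg_of_le {c s t a b T Q : ℝ} (hc0 : 0 < c) (hc2 : c ≤ 2)
    (hs : s ≤ 1) (ht : -1 ≤ t) (hts : t ≤ s) (hb : 0 < b) (hba : b ≤ a) (hT : 0 ≤ T)
    (hQ : 0 ≤ Q) :
    0 ≤ (a * (exp (c * s) * ((1 - s) * (1 + t))) - b * (exp (c * t) * ((1 - t) * (1 + s)))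
          - (s - t) * Q) / (a * exp (c * s) + b * exp (c * t) + T) ^ 3
        + (a * (exp (c * t) * ((1 - t) * (1 + s))) - b * (exp (c * s) * ((1 - s) * (1 + t)))
          - (t - s) * Q) / (a * exp (c * t) + b * exp (c * s) + T) ^ 3 ∧
    (b < a → ¬ (s = t ∧ s ^ 2 = 1) →
      0 < (a * (exp (c * s) * ((1 - s) * (1 + t))) - b * (exp (c * t) * ((1 - t) * (1 + s)))
          - (s - t) * Q) / (a * exp (c * s) + b * exp (c * t) + T) ^ 3
        + (a * (exp (c * t) * ((1 - t) * (1 + s))) - b * (exp (c * s) * ((1 - s) * (1 + t)))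
          - (t - s) * Q) / (a * exp (c * t) + b * exp (c * s) + T) ^ 3) := by
  have hAB := exp_mul_one_sub_mul_one_add_le hc2 hs ht hts
  have hexp : exp (c * t) ≤ exp (c * s) :=
    exp_le_exp.2 (mul_le_mul_of_nonneg_left hts hc0.le)
  have het := exp_pos (c * t)
  have hA : 0 ≤ exp (c * s) * ((1 - s) * (1 + t)) :=
    mul_nonneg (exp_pos _).le (mul_nonneg (by linarith) (by linarith))
  have hB : t ≠ 1 → s ≠ -1 → 0 < exp (c * t) * ((1 - t) * (1 + s)) := fun h1 h2 =>
    mul_pos (exp_pos _) (mul_pos (sub_pos.2 (lt_of_le_of_ne (hts.trans hs) h1))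
      (by linarith [lt_of_le_of_ne (ht.trans hts) (Ne.symm h2)]))
  set A := exp (c * s) * ((1 - s) * (1 + t))
  set B := exp (c * t) * ((1 - t) * (1 + s))
  set es := exp (c * s)
  set et := exp (c * t)
  have ha : 0 < a := hb.trans_le hba
  have hS2 : 0 < a * et + b * es + T := by
    have := mul_pos ha het
    have := mul_pos hb (het.trans_le hexp)
    linarith
  have hS : a * et + b * es + T ≤ a * es + b * et + T := by
    nlinarith [mul_nonneg (sub_nonneg.2 hba) (sub_nonneg.2 hexp)]
  have hS1 := hS2.trans_le hS
  have hcube : (a * et + b * es + T) ^ 3 ≤ (a * es + b * et + T) ^ 3 := by gcongr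
  have hN : 0 ≤ a * B - b * A - (t - s) * Q := by
    nlinarith [mul_nonneg (sub_nonneg.2 hts) hQ, mul_nonneg (sub_nonneg.2 hba) hA,
      mul_nonneg ha.le (sub_nonneg.2 hAB)]
  have hle : ((a - b) * (A + B)) / (a * es + b * et + T) ^ 3 ≤
      (a * A - b * B - (s - t) * Q) / (a * es + b * et + T) ^ 3
        + (a * B - b * A - (t - s) * Q) / (a * et + b * es + T) ^ 3 := by
    calc ((a - b) * (A + B)) / (a * es + b * et + T) ^ 3
        = (a * A - b * B - (s - t) * Q) / (a * es + b * et + T) ^ 3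
          + (a * B - b * A - (t - s) * Q) / (a * es + b * et + T) ^ 3 := by
          rw [← add_div]; ring
      _ ≤ _ := by gcongr
  refine ⟨le_trans ?_ hle, fun hlt hst => lt_of_lt_of_le ?_ hle⟩
  · exact div_nonneg (mul_nonneg (sub_nonneg.2 hba) (add_nonneg hA (hA.trans hAB)))
      (pow_pos hS1 3).le
  · refine div_pos (mul_pos (sub_pos.2 hlt) (add_pos_of_nonneg_of_pos hA (hB ?_ ?_)))
      (pow_pos hS1 3)
    · rintro rfl
      exact hst ⟨le_antisymm hs hts, by rw [le_antisymm hs hts]; norm_num⟩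
    · rintro rfl
      exact hst ⟨le_antisymm ht hts, by norm_num⟩

/-- The symmetrised pair term is nonnegative, and positive outside the degenerate case. -/
lemma pair_term_nonneg {c s t a b T Q : ℝ} (hc0 : 0 < c) (hc2 : c ≤ 2)
    (hs : |s| ≤ 1) (ht : |t| ≤ 1) (hb : 0 < b) (hba : b ≤ a) (hT : 0 ≤ T) (hQ : 0 ≤ Q) :
    0 ≤ (a * (exp (c * s) * ((1 - s) * (1 + t))) - b * (exp (c * t) * ((1 - t) * (1 + s)))
          - (s - t) * Q) / (a * exp (c * s) + b * exp (c * t) + T) ^ 3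
        + (a * (exp (c * t) * ((1 - t) * (1 + s))) - b * (exp (c * s) * ((1 - s) * (1 + t)))
          - (t - s) * Q) / (a * exp (c * t) + b * exp (c * s) + T) ^ 3 ∧
    (b < a → ¬ (s = t ∧ s ^ 2 = 1) →
      0 < (a * (exp (c * s) * ((1 - s) * (1 + t))) - b * (exp (c * t) * ((1 - t) * (1 + s)))
          - (s - t) * Q) / (a * exp (c * s) + b * exp (c * t) + T) ^ 3
        + (a * (exp (c * t) * ((1 - t) * (1 + s))) - b * (exp (c * s) * ((1 - s) * (1 + t)))
          - (t - s) * Q) / (a * exp (c * t) + b * exp (c * s) + T) ^ 3) := by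
  rw [abs_le] at hs ht
  rcases le_total t s with h | h
  · exact pair_term_nonneg_of_le hc0 hc2 hs.2 ht.1 h hb hba hT hQ
  · have := pair_term_nonneg_of_le hc0 hc2 ht.2 hs.1 h hb hba hT hQ
    refine ⟨by rw [add_comm]; exact this.1, fun h1 h2 => ?_⟩
    rw [add_comm]
    refine this.2 h1 fun h3 => h2 ⟨h3.1.symm, by rw [← h3.1]; exact h3.2⟩

section Symmetrization

variable {E : Type*} [NormedAddCommGroup E] [InnerProductSpace ℝ E] {ι : Type*} [Fintype ι]

/-- The unnormalised softmax weight of the `i`-th sample. -/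
def weight (u : E) (c : ℝ) (α : ι → ℝ) (us : ι → E) (i : ι) : ℝ :=
  exp (c * ⟪us i, u⟫) * α i

/-- The total softmax weight. -/
def weightSum (u : E) (c : ℝ) (α : ι → ℝ) (us : ι → E) : ℝ :=
  ∑ i, weight u c α us i

/-- The unnormalised weighted deviation from `u`. -/
def weightVec (u : E) (c : ℝ) (α : ι → ℝ) (us : ι → E) : E :=
  ∑ i, weight u c α us i • (us i - u)

/-- The contribution of the pair `(i, j)` to the derivative of the signal with respect to `α i`. -/
def pairTerm (u : E) (c : ℝ) (α : ι → ℝ) (i j : ι) (us : ι → E) : ℝ :=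
  exp (c * ⟪us i, u⟫) * exp (c * ⟪us j, u⟫) * ⟪us i - us j, weightVec u c α us⟫ /
    weightSum u c α us ^ 3

/-- The part of `pairTerm` coming from the components orthogonal to `u` of the sample `a` and of
the other samples. -/
def orthTerm (u : E) (c : ℝ) (α : ι → ℝ) [DecidableEq ι] (i j a : ι) (us : ι → E) : ℝ :=
  exp (c * ⟪us i, u⟫) * exp (c * ⟪us j, u⟫) *
    (∑ l ∈ Finset.univ.erase a, weight u c α us l * (⟪us a, us l⟫ - ⟪us a, u⟫ * ⟪us l, u⟫)) /
    weightSum u c α us ^ 3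

/-- The part of `pairTerm` which only depends on the projections of the samples to `u`. -/
def projTerm (u : E) (c : ℝ) (α : ι → ℝ) [DecidableEq ι] (i j : ι) (us : ι → E) : ℝ :=
  exp (c * ⟪us i, u⟫) * exp (c * ⟪us j, u⟫) *
    ((α i * (exp (c * ⟪us i, u⟫) * ((1 - ⟪us i, u⟫) * (1 + ⟪us j, u⟫)))
        - α j * (exp (c * ⟪us j, u⟫) * ((1 - ⟪us j, u⟫) * (1 + ⟪us i, u⟫)))
        - (⟪us i, u⟫ - ⟪us j, u⟫) *
          ∑ l ∈ (Finset.univ.erase i).erase j, weight u c α us l * (1 - ⟪us l, u⟫)) /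
      (α i * exp (c * ⟪us i, u⟫) + α j * exp (c * ⟪us j, u⟫)
        + ∑ l ∈ (Finset.univ.erase i).erase j, weight u c α us l) ^ 3)

omit [Fintype ι] in
lemma weight_pos (u : E) (c : ℝ) {α : ι → ℝ} (hα : ∀ i, 0 < α i) (us : ι → E) (i : ι) :
    0 < weight u c α us i :=
  mul_pos (exp_pos _) (hα i)

lemma weightSum_pos [Nonempty ι] (u : E) (c : ℝ) {α : ι → ℝ} (hα : ∀ i, 0 < α i) (us : ι → E) :
    0 < weightSum u c α us :=
  Finset.sum_pos (fun i _ => weight_pos u c hα us i) Finset.univ_nonempty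

lemma sum_eq_add_add_sum_erase [DecidableEq ι] {i j : ι} (hij : i ≠ j) (f : ι → ℝ) :
    ∑ l, f l = f i + f j + ∑ l ∈ (Finset.univ.erase i).erase j, f l := by
  rw [← Finset.add_sum_erase _ f (Finset.mem_univ i),
    ← Finset.add_sum_erase (Finset.univ.erase i) f (a := j) (by simp [hij.symm]), add_assoc]

lemma weightSum_eq [DecidableEq ι] {i j : ι} (hij : i ≠ j) (u : E) (c : ℝ) (α : ι → ℝ)
    (us : ι → E) :
    weightSum u c α us = α i * exp (c * ⟪us i, u⟫) + α j * exp (c * ⟪us j, u⟫)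
        + ∑ l ∈ (Finset.univ.erase i).erase j, weight u c α us l := by
  rw [weightSum, sum_eq_add_add_sum_erase hij, weight, weight, mul_comm (α i), mul_comm (α j)]

lemma pairTerm_eq [DecidableEq ι] {i j : ι} (hij : i ≠ j) (u : E) (c : ℝ) (α : ι → ℝ)
    {us : ι → E} (hi : ‖us i‖ = 1) (hj : ‖us j‖ = 1) :
    pairTerm u c α i j us =
      projTerm u c α i j us + orthTerm u c α i j i us - orthTerm u c α i j j us := by
  have hii : ⟪us i, us i⟫ = 1 := by rw [real_inner_self_eq_norm_sq, hi, one_pow]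
  have hjj : ⟪us j, us j⟫ = 1 := by rw [real_inner_self_eq_norm_sq, hj, one_pow]
  have hV : ⟪us i - us j, weightVec u c α us⟫ = ∑ l, weight u c α us l *
      (⟪us i, us l⟫ - ⟪us i, u⟫ - ⟪us j, us l⟫ + ⟪us j, u⟫) := by
    rw [weightVec, inner_sum]
    refine Finset.sum_congr rfl fun l _ => ?_
    rw [real_inner_smul_right, inner_sub_left, inner_sub_right, inner_sub_right]
    ring
  have hrest : ∑ l ∈ (Finset.univ.erase i).erase j, weight u c α us l *
      (⟪us i, us l⟫ - ⟪us i, u⟫ - ⟪us j, us l⟫ + ⟪us j, u⟫) =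
      ∑ l ∈ (Finset.univ.erase i).erase j,
          weight u c α us l * (⟪us i, us l⟫ - ⟪us i, u⟫ * ⟪us l, u⟫)
      - ∑ l ∈ (Finset.univ.erase i).erase j,
          weight u c α us l * (⟪us j, us l⟫ - ⟪us j, u⟫ * ⟪us l, u⟫)
      - (⟪us i, u⟫ - ⟪us j, u⟫) *
        ∑ l ∈ (Finset.univ.erase i).erase j, weight u c α us l * (1 - ⟪us l, u⟫) := by
    rw [Finset.mul_sum, ← Finset.sum_sub_distrib, ← Finset.sum_sub_distrib]
    exact Finset.sum_congr rfl fun l _ => by ring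
  rw [pairTerm, projTerm, orthTerm, orthTerm, hV, ← weightSum_eq hij, ← mul_div_assoc, ← add_div,
    ← sub_div, sum_eq_add_add_sum_erase hij, hrest,
    ← Finset.add_sum_erase (Finset.univ.erase i) _ (a := j) (by simp [hij.symm]),
    ← Finset.add_sum_erase (Finset.univ.erase j) _ (a := i) (by simp [hij]),
    Finset.erase_right_comm (a := j) (b := i), hii, hjj, real_inner_comm (us i) (us j)]
  simp only [weight]
  congr 1
  ring

lemma projTerm_add_swap [DecidableEq ι] {i j : ι} {u : E} (hu : ‖u‖ = 1) {c : ℝ}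
    (hc0 : 0 < c) (hc2 : c ≤ 2) {α : ι → ℝ} (hα : ∀ l, 0 < α l) (hji : α j ≤ α i)
    {us : ι → E} (hus : ∀ l, ‖us l‖ = 1) :
    0 ≤ projTerm u c α i j us + projTerm u c α i j (fun l => us (Equiv.swap i j l)) ∧
    (α j < α i → ¬ (⟪us i, u⟫ = ⟪us j, u⟫ ∧ ⟪us i, u⟫ ^ 2 = 1) →
      0 < projTerm u c α i j us + projTerm u c α i j (fun l => us (Equiv.swap i j l))) := by
  have hx : ∀ l, |⟪us l, u⟫| ≤ 1 := fun l => by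
    simpa [hus l, hu] using abs_real_inner_le_norm (us l) u
  have hrest : ∀ l ∈ (Finset.univ.erase i).erase j, us (Equiv.swap i j l) = us l := by
    intro l hl
    simp only [Finset.mem_erase, Finset.mem_univ, and_true] at hl
    rw [Equiv.swap_apply_of_ne_of_ne hl.2 hl.1]
  have hT : 0 ≤ ∑ l ∈ (Finset.univ.erase i).erase j, weight u c α us l :=
    Finset.sum_nonneg fun l _ => (weight_pos u c hα us l).le
  have hQ : 0 ≤ ∑ l ∈ (Finset.univ.erase i).erase j, weight u c α us l * (1 - ⟪us l, u⟫) :=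
    Finset.sum_nonneg fun l _ => mul_nonneg (weight_pos u c hα us l).le
      (sub_nonneg.2 (abs_le.1 (hx l)).2)
  have hT' : ∑ l ∈ (Finset.univ.erase i).erase j,
      weight u c α (fun l => us (Equiv.swap i j l)) l =
      ∑ l ∈ (Finset.univ.erase i).erase j, weight u c α us l :=
    Finset.sum_congr rfl fun l hl => by simp only [weight, hrest l hl]
  have hQ' : ∑ l ∈ (Finset.univ.erase i).erase j,
      weight u c α (fun l => us (Equiv.swap i j l)) l * (1 - ⟪us (Equiv.swap i j l), u⟫) =
      ∑ l ∈ (Finset.univ.erase i).erase j, weight u c α us l * (1 - ⟪us l, u⟫) :=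
    Finset.sum_congr rfl fun l hl => by simp only [weight, hrest l hl]
  have key := pair_term_nonneg hc0 hc2 (hx i) (hx j) (hα j) hji hT hQ
  rw [projTerm, projTerm, hT', hQ']
  simp only [Equiv.swap_apply_left, Equiv.swap_apply_right]
  rw [mul_comm (exp (c * ⟪us j, u⟫)) (exp (c * ⟪us i, u⟫)), ← mul_add]
  exact ⟨mul_nonneg (by positivity) key.1, fun h1 h2 => mul_pos (by positivity) (key.2 h1 h2)⟩

omit [Fintype ι] in
lemma continuous_weight (u : E) (c : ℝ) (α : ι → ℝ) (l : ι) :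
    Continuous fun us : ι → E => weight u c α us l := by
  unfold weight; fun_prop

lemma continuous_weightSum (u : E) (c : ℝ) (α : ι → ℝ) :
    Continuous (weightSum (ι := ι) u c α) :=
  continuous_finsetSum _ fun l _ => continuous_weight u c α l

lemma continuous_weightVec (u : E) (c : ℝ) (α : ι → ℝ) :
    Continuous (weightVec (ι := ι) u c α) :=
  continuous_finsetSum _ fun l _ => (continuous_weight u c α l).smul (by fun_prop)

lemma continuous_pairTerm (u : E) (c : ℝ) {α : ι → ℝ} (hα : ∀ l, 0 < α l) (i j : ι) :
    Continuous (pairTerm u c α i j) := by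
  have : Nonempty ι := ⟨i⟩
  have h1 := continuous_weightSum u c α
  have h2 := continuous_weightVec u c α
  unfold pairTerm
  exact Continuous.div (by fun_prop) (by fun_prop)
    fun us => (pow_pos (weightSum_pos u c hα us) 3).ne'

lemma continuous_orthTerm [DecidableEq ι] (u : E) (c : ℝ) {α : ι → ℝ} (hα : ∀ l, 0 < α l)
    (i j a : ι) : Continuous (orthTerm u c α i j a) := by
  have : Nonempty ι := ⟨i⟩
  have h1 := continuous_weightSum u c α
  have h2 := continuous_weight (ι := ι) u c α
  unfold orthTerm
  exact Continuous.div (by fun_prop) (by fun_prop)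
    fun us => (pow_pos (weightSum_pos u c hα us) 3).ne'

lemma continuous_projTerm [DecidableEq ι] (u : E) (c : ℝ) {α : ι → ℝ} (hα : ∀ l, 0 < α l)
    {i j : ι} (hij : i ≠ j) : Continuous (projTerm u c α i j) := by
  have : Nonempty ι := ⟨i⟩
  have h1 := continuous_weightSum u c α
  have h2 := continuous_weight (ι := ι) u c α
  unfold projTerm
  simp only [← weightSum_eq hij]
  exact Continuous.mul (by fun_prop) (Continuous.div (by fun_prop) (by fun_prop)
    fun us => (pow_pos (weightSum_pos u c hα us) 3).ne')

variable [FiniteDimensional ℝ E] [MeasurableSpace E] [BorelSpace E] {μ : Measure E}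
  [IsProbabilityMeasure μ]

omit [BorelSpace E] in
lemma ae_pi_norm_eq_one (hμ : ∀ᵐ x ∂μ, ‖x‖ = 1) :
    ∀ᵐ us ∂(Measure.pi fun _ : ι => μ), ∀ i, ‖us i‖ = 1 :=
  ae_all_iff.2 fun i => (Measure.tendsto_eval_ae_ae (μ := fun _ : ι => μ) (i := i)).eventually hμ

lemma integrable_pi_of_continuous (hμ : ∀ᵐ x ∂μ, ‖x‖ = 1) {F : (ι → E) → ℝ}
    (hF : Continuous F) : Integrable F (Measure.pi fun _ : ι => μ) := by
  obtain ⟨C, hC⟩ := (isCompact_closedBall (0 : ι → E) 1).exists_bound_of_continuousOn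
    hF.continuousOn
  refine Integrable.of_bound hF.aestronglyMeasurable C ?_
  filter_upwards [ae_pi_norm_eq_one hμ] with us hus
  refine hC us ?_
  rw [mem_closedBall_zero_iff, pi_norm_le_iff_of_nonneg zero_le_one]
  exact fun i => (hus i).le

omit [IsProbabilityMeasure μ] in
lemma integral_comp_of_continuous {Φ : (ι → E) → (ι → E)}
    (hΦ : MeasurePreserving Φ (Measure.pi fun _ : ι => μ) (Measure.pi fun _ : ι => μ))
    {F : (ι → E) → ℝ} (hF : Continuous F) :
    ∫ us, F (Φ us) ∂(Measure.pi fun _ : ι => μ) = ∫ us, F us ∂(Measure.pi fun _ : ι => μ) := by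
  rw [← integral_map hΦ.measurable.aemeasurable hF.aestronglyMeasurable, hΦ.map_eq]

omit [BorelSpace E] in
lemma measurePreserving_pi_apply_at [DecidableEq ι] {ρ : E → E} (hρ : MeasurePreserving ρ μ μ)
    (a : ι) :
    MeasurePreserving (fun (us : ι → E) l => if l = a then ρ (us l) else us l)
      (Measure.pi fun _ : ι => μ) (Measure.pi fun _ : ι => μ) := by
  have h := measurePreserving_pi (fun _ : ι => μ) (fun _ : ι => μ)
    (f := fun l x => if l = a then ρ x else x) fun l => by
      by_cases hl : l = a
      · simpa [hl] using hρ
      · simp only [hl, if_false]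
        exact MeasurePreserving.id μ
  exact h

omit [BorelSpace E] in
lemma measurePreserving_pi_comp_equiv (e : ι ≃ ι) :
    MeasurePreserving (fun (us : ι → E) l => us (e l))
      (Measure.pi fun _ : ι => μ) (Measure.pi fun _ : ι => μ) := by
  have h := measurePreserving_piCongrLeft (fun _ : ι => μ) e.symm
  convert h using 1
  ext us l
  have := Equiv.piCongrLeft_apply_apply (fun _ : ι => E) e.symm us (e l)
  rw [Equiv.symm_apply_apply] at this
  rw [MeasurableEquiv.coe_piCongrLeft, this]

lemma integral_orthTerm_eq_zero [DecidableEq ι]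
    (hinv : ∀ ρ : E ≃ₗᵢ[ℝ] E, MeasurePreserving ρ μ μ) {u : E} (hu : ‖u‖ = 1) (c : ℝ)
    {α : ι → ℝ} (hα : ∀ l, 0 < α l) (i j a : ι) :
    ∫ us, orthTerm u c α i j a us ∂(Measure.pi fun _ : ι => μ) = 0 := by
  set ρ : E ≃ₗᵢ[ℝ] E := (ℝ ∙ u).reflection with hρ
  have hρv : ∀ v, ρ v = (2 * ⟪v, u⟫) • u - v := fun v => by
    rw [hρ, Submodule.reflection_singleton_apply, hu, real_inner_comm]
    simp [two_smul, two_mul, add_smul]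
  have hρu : ∀ v, ⟪ρ v, u⟫ = ⟪v, u⟫ := fun v => by
    rw [hρv, inner_sub_left, real_inner_smul_left, real_inner_self_eq_norm_sq, hu]; ring
  have h := integral_comp_of_continuous (measurePreserving_pi_apply_at (hinv ρ) a)
    (continuous_orthTerm u c hα i j a)
  have hproj : ∀ (us : ι → E) l, ⟪if l = a then ρ (us l) else us l, u⟫ = ⟪us l, u⟫ := by
    intro us l; split_ifs
    · exact hρu _
    · rfl
  have hodd : ∀ us : ι → E, orthTerm u c α i j a (fun l => if l = a then ρ (us l) else us l) =
      - orthTerm u c α i j a us := by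
    intro us
    simp only [orthTerm, weightSum, weight, hproj]
    rw [← neg_div, ← mul_neg, ← Finset.sum_neg_distrib]
    congr 2
    refine Finset.sum_congr rfl fun l hl => ?_
    rw [if_neg (Finset.ne_of_mem_erase hl)]
    simp only [if_true]
    rw [hρu, hρv, inner_sub_left,
      real_inner_smul_left, real_inner_comm (us l) u]
    ring
  simp only [hodd, integral_neg] at h
  linarith

lemma integral_pairTerm_eq [DecidableEq ι] (hμ : ∀ᵐ x ∂μ, ‖x‖ = 1)
    (hinv : ∀ ρ : E ≃ₗᵢ[ℝ] E, MeasurePreserving ρ μ μ) {u : E} (hu : ‖u‖ = 1) (c : ℝ)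
    {α : ι → ℝ} (hα : ∀ l, 0 < α l) {i j : ι} (hij : i ≠ j) :
    ∫ us, pairTerm u c α i j us ∂(Measure.pi fun _ : ι => μ) =
      ∫ us, projTerm u c α i j us ∂(Measure.pi fun _ : ι => μ) := by
  have hp := integrable_pi_of_continuous hμ (continuous_projTerm u c hα hij)
  have ho := fun a => integrable_pi_of_continuous hμ (continuous_orthTerm u c hα i j a)
  calc ∫ us, pairTerm u c α i j us ∂(Measure.pi fun _ : ι => μ)
      = ∫ us, (projTerm u c α i j us + orthTerm u c α i j i us - orthTerm u c α i j j us)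
          ∂(Measure.pi fun _ : ι => μ) := by
        refine integral_congr_ae ?_
        filter_upwards [ae_pi_norm_eq_one hμ] with us hus
        exact pairTerm_eq hij u c α (hus i) (hus j)
    _ = _ := by
        rw [integral_sub (f := fun us => projTerm u c α i j us + orthTerm u c α i j i us)
            (hp.add (ho i)) (ho j), integral_add hp (ho i),
          integral_orthTerm_eq_zero hinv hu c hα, integral_orthTerm_eq_zero hinv hu c hα]
        ring

omit [BorelSpace E] in
/-- Two samples do not almost surely project to the same pole `± u`. -/
lemma not_ae_inner_eq (hinv : ∀ ρ : E ≃ₗᵢ[ℝ] E, MeasurePreserving ρ μ μ) (u : E) {i j : ι} (hij : i ≠ j) :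
    ¬ ∀ᵐ us ∂(Measure.pi fun _ : ι => μ), ⟪us i, u⟫ = ⟪us j, u⟫ ∧ ⟪us i, u⟫ ^ 2 = 1 := by
  classical
  intro h
  have h' := (measurePreserving_pi_apply_at (hinv (LinearIsometryEquiv.neg ℝ))
    i).quasiMeasurePreserving.tendsto_ae.eventually h
  obtain ⟨us, h1, h2⟩ := (h.and h').exists
  simp only [if_pos, if_neg hij.symm, LinearIsometryEquiv.coe_neg, inner_neg_left] at h2
  have : ⟪us i, u⟫ = 0 := by linarith [h1.1, h2.1]
  rw [this] at h1
  norm_num at h1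

lemma integral_pairTerm_nonneg (hμ : ∀ᵐ x ∂μ, ‖x‖ = 1)
    (hinv : ∀ ρ : E ≃ₗᵢ[ℝ] E, MeasurePreserving ρ μ μ) {u : E} (hu : ‖u‖ = 1) {c : ℝ}
    (hc0 : 0 < c) (hc2 : c ≤ 2) {α : ι → ℝ} (hα : ∀ l, 0 < α l) {i j : ι} (hji : α j ≤ α i) :
    0 ≤ ∫ us, pairTerm u c α i j us ∂(Measure.pi fun _ : ι => μ) ∧
    (α j < α i → 0 < ∫ us, pairTerm u c α i j us ∂(Measure.pi fun _ : ι => μ)) := by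
  classical
  rcases eq_or_ne i j with rfl | hij
  · simp [pairTerm]
  rw [integral_pairTerm_eq hμ hinv hu c hα hij]
  have hcont := continuous_projTerm u c hα hij
  have hp := integrable_pi_of_continuous hμ hcont
  have hps : Integrable (fun us => projTerm u c α i j fun l => us (Equiv.swap i j l))
      (Measure.pi fun _ : ι => μ) := integrable_pi_of_continuous hμ
    (hcont.comp (by fun_prop : Continuous fun (us : ι → E) l => us (Equiv.swap i j l)))
  have hsum : ∫ us, (projTerm u c α i j us + projTerm u c α i j fun l => us (Equiv.swap i j l))
      ∂(Measure.pi fun _ : ι => μ) =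
      2 * ∫ us, projTerm u c α i j us ∂(Measure.pi fun _ : ι => μ) := by
    rw [integral_add hp hps, integral_comp_of_continuous (measurePreserving_pi_comp_equiv _) hcont,
      two_mul]
  have hae : 0 ≤ᵐ[Measure.pi fun _ : ι => μ] fun us =>
      projTerm u c α i j us + projTerm u c α i j fun l => us (Equiv.swap i j l) := by
    filter_upwards [ae_pi_norm_eq_one hμ] with us hus
    exact (projTerm_add_swap hu hc0 hc2 hα hji hus).1
  have hnn := integral_nonneg_of_ae hae
  refine ⟨by linarith, fun hlt => ?_⟩
  refine lt_of_le_of_ne (by linarith) fun h0 => not_ae_inner_eq hinv u hij ?_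
  rw [← h0, mul_zero, integral_eq_zero_iff_of_nonneg_ae hae (hp.add hps)] at hsum
  filter_upwards [ae_pi_norm_eq_one hμ, hsum] with us hus hz
  by_contra hcon
  exact ((projTerm_add_swap hu hc0 hc2 hα hji hus).2 hlt hcon).ne' hz

omit [FiniteDimensional ℝ E] [MeasurableSpace E] [BorelSpace E] in
lemma signal_integrand_eq (u : E) (c : ℝ) (α : ι → ℝ) (us : ι → E) :
    (∑ i, ∑ j, ⟪us i - u, us j - u⟫ * exp (c * ⟪us i, u⟫ + c * ⟪us j, u⟫) * α i * α j) /
      (∑ i, exp (c * ⟪us i, u⟫) * α i) ^ 2 =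
    ⟪weightVec u c α us, weightVec u c α us⟫ / weightSum u c α us ^ 2 := by
  rw [weightVec, sum_inner]
  simp only [inner_sum, real_inner_smul_left, real_inner_smul_right, weight, weightSum, exp_add]
  congr 1
  exact Finset.sum_congr rfl fun i _ => Finset.sum_congr rfl fun j _ => by ring

/-- The partial derivative of the integrand of the signal with respect to `α i`. -/
def signalDeriv (u : E) (c : ℝ) (α : ι → ℝ) (i : ι) (us : ι → E) : ℝ :=
  (2 * (exp (c * ⟪us i, u⟫) * ⟪us i - u, weightVec u c α us⟫) * weightSum u c α us ^ 2
    - ⟪weightVec u c α us, weightVec u c α us⟫ *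
      (2 * weightSum u c α us * exp (c * ⟪us i, u⟫))) / (weightSum u c α us ^ 2) ^ 2

omit [FiniteDimensional ℝ E] [MeasurableSpace E] [BorelSpace E] in
lemma hasDerivAt_signal_integrand [DecidableEq ι] (u : E) (c : ℝ) {α : ι → ℝ}
    (hα : ∀ l, 0 < α l) (i : ι) {t : ℝ} (ht : 0 < t) (us : ι → E) :
    HasDerivAt (fun t => ⟪weightVec u c (Function.update α i t) us,
        weightVec u c (Function.update α i t) us⟫ / weightSum u c (Function.update α i t) us ^ 2)
      (signalDeriv u c (Function.update α i t) i us) t := by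
  have : Nonempty ι := ⟨i⟩
  have hpos : ∀ l, 0 < Function.update α i t l := by
    intro l; rcases eq_or_ne l i with rfl | h <;> simp [*]
  have hw : ∀ l, HasDerivAt (fun t => weight u c (Function.update α i t) us l)
      (exp (c * ⟪us l, u⟫) * (Pi.single i 1 : ι → ℝ) l) t := fun l =>
    ((hasDerivAt_pi.1 (hasDerivAt_update α i t)) l).const_mul _
  have hS : HasDerivAt (fun t => weightSum u c (Function.update α i t) us)
      (exp (c * ⟪us i, u⟫)) t := by
    refine (HasDerivAt.fun_sum fun l (_ : l ∈ Finset.univ) => hw l).congr_deriv ?_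
    simp [Pi.single_apply]
  have hV : HasDerivAt (fun t => weightVec u c (Function.update α i t) us)
      (exp (c * ⟪us i, u⟫) • (us i - u)) t := by
    refine (HasDerivAt.fun_sum fun l (_ : l ∈ Finset.univ) =>
      (hw l).smul_const (us l - u)).congr_deriv ?_
    simp [Pi.single_apply]
  have hSpos := weightSum_pos u c hpos us
  refine ((hV.inner ℝ hV).div (hS.fun_pow 2) (pow_pos hSpos 2).ne').congr_deriv ?_
  rw [signalDeriv, real_inner_smul_left, real_inner_smul_right,
    real_inner_comm (us i - u) (weightVec u c (Function.update α i t) us)]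
  congr 1
  ring

omit [FiniteDimensional ℝ E] [MeasurableSpace E] [BorelSpace E] in
lemma signalDeriv_eq_sum_pairTerm (u : E) (c : ℝ) {α : ι → ℝ} (hα : ∀ l, 0 < α l) (i : ι)
    (us : ι → E) :
    signalDeriv u c α i us = ∑ j, 2 * α j * pairTerm u c α i j us := by
  have : Nonempty ι := ⟨i⟩
  have hS := (weightSum_pos u c hα us).ne'
  have hsum : ∑ j, 2 * α j * pairTerm u c α i j us =
      2 * exp (c * ⟪us i, u⟫) * (weightSum u c α us * ⟪us i - u, weightVec u c α us⟫
        - ⟪weightVec u c α us, weightVec u c α us⟫) / weightSum u c α us ^ 3 := by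
    have h1 : weightSum u c α us * ⟪us i - u, weightVec u c α us⟫
        - ⟪weightVec u c α us, weightVec u c α us⟫ =
        ∑ j, weight u c α us j * ⟪us i - us j, weightVec u c α us⟫ := by
      conv_lhs => rw [weightSum, Finset.sum_mul]
      conv_lhs => enter [2]; rw [weightVec, sum_inner]
      rw [← Finset.sum_sub_distrib]
      refine Finset.sum_congr rfl fun j _ => ?_
      rw [real_inner_smul_left, ← mul_sub, ← weightVec, ← inner_sub_left, sub_sub_sub_cancel_right]
    rw [h1, Finset.mul_sum, Finset.sum_div]
    refine Finset.sum_congr rfl fun j _ => ?_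
    rw [pairTerm, weight]
    ring
  rw [hsum, signalDeriv]
  field_simp

omit [FiniteDimensional ℝ E] [MeasurableSpace E] [BorelSpace E] in
lemma continuousOn_signalDeriv [DecidableEq ι] (u : E) (c : ℝ) {α : ι → ℝ}
    (hα : ∀ l, 0 < α l) (i : ι) :
    ContinuousOn (fun p : ℝ × (ι → E) => signalDeriv u c (Function.update α i p.1) i p.2)
      {p | 0 < p.1} := by
  have : Nonempty ι := ⟨i⟩
  have hα' : ∀ l, Continuous fun p : ℝ × (ι → E) => Function.update α i p.1 l := fun l =>
    (continuous_apply (A := fun _ : ι => ℝ) l).comp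
      ((continuous_const (y := α)).update i continuous_fst)
  have hS : Continuous fun p : ℝ × (ι → E) => weightSum u c (Function.update α i p.1) p.2 := by
    unfold weightSum weight; fun_prop
  have hV : Continuous fun p : ℝ × (ι → E) => weightVec u c (Function.update α i p.1) p.2 := by
    unfold weightVec weight; fun_prop
  unfold signalDeriv
  refine ContinuousOn.div (Continuous.continuousOn (by fun_prop))
    (Continuous.continuousOn (by fun_prop)) fun p hp => ?_
  have hpos : ∀ l, 0 < Function.update α i p.1 l := by
    intro l
    rcases eq_or_ne l i with rfl | h
    · simpa using hp
    · simpa [h] using hα l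
  exact (pow_pos (pow_pos (weightSum_pos u c hpos _) 2) 2).ne'

lemma hasDerivAt_integral_signal [DecidableEq ι] (hμ : ∀ᵐ x ∂μ, ‖x‖ = 1) (u : E) (c : ℝ)
    {α : ι → ℝ} (hα : ∀ l, 0 < α l) (i : ι) :
    HasDerivAt (fun t => ∫ us, ⟪weightVec u c (Function.update α i t) us,
        weightVec u c (Function.update α i t) us⟫ / weightSum u c (Function.update α i t) us ^ 2
        ∂(Measure.pi fun _ : ι => μ))
      (∑ j, 2 * α j * ∫ us, pairTerm u c α i j us ∂(Measure.pi fun _ : ι => μ)) (α i) := by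
  have : Nonempty ι := ⟨i⟩
  have hcont : ∀ t, 0 < t → Continuous fun us : ι → E =>
      ⟪weightVec u c (Function.update α i t) us, weightVec u c (Function.update α i t) us⟫ /
        weightSum u c (Function.update α i t) us ^ 2 := by
    intro t ht
    have hpos : ∀ l, 0 < Function.update α i t l := by
      intro l; rcases eq_or_ne l i with rfl | h <;> simp [*]
    have h1 := continuous_weightSum (ι := ι) u c (Function.update α i t)
    have h2 := continuous_weightVec (ι := ι) u c (Function.update α i t)
    exact (h2.inner h2).div (h1.pow 2) fun us => (pow_pos (weightSum_pos u c hpos us) 2).ne'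
  have hd := continuousOn_signalDeriv u c hα i
  obtain ⟨C, hC⟩ := ((isCompact_Icc (a := α i / 2) (b := 2 * α i)).prod
    (isCompact_closedBall (0 : ι → E) 1)).exists_bound_of_continuousOn
    (hd.mono fun p hp => (half_pos (hα i)).trans_le hp.1.1)
  have hderiv : ∀ us, signalDeriv u c (Function.update α i (α i)) i us =
      ∑ j, 2 * α j * pairTerm u c α i j us := fun us => by
    rw [Function.update_eq_self, signalDeriv_eq_sum_pairTerm u c hα]
  have h := (hasDerivAt_integral_of_dominated_loc_of_deriv_le
    (μ := Measure.pi fun _ : ι => μ) (bound := fun _ => C)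
    (F := fun t us => ⟪weightVec u c (Function.update α i t) us,
        weightVec u c (Function.update α i t) us⟫ / weightSum u c (Function.update α i t) us ^ 2)
    (F' := fun t us => signalDeriv u c (Function.update α i t) i us)
    (Icc_mem_nhds (half_lt_self (hα i)) (by linarith [hα i] : α i < 2 * α i))
    ?_ (integrable_pi_of_continuous hμ (hcont _ (hα i))) ?_ ?_ (integrable_const C) ?_).2
  · refine h.congr_deriv ?_
    simp only [hderiv]
    rw [integral_finsetSum _ fun j _ =>
      (integrable_pi_of_continuous hμ (continuous_pairTerm u c hα i j)).const_mul _]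
    simp only [integral_const_mul]
  · filter_upwards [lt_mem_nhds (hα i)] with t ht
    exact (hcont t ht).aestronglyMeasurable
  · simp only [hderiv]
    exact (continuous_finsetSum _ fun j _ =>
      (continuous_pairTerm u c hα i j).const_mul _).aestronglyMeasurable
  · filter_upwards [ae_pi_norm_eq_one hμ] with us hus t ht
    refine hC (t, us) ⟨ht, ?_⟩
    rw [mem_closedBall_zero_iff, pi_norm_le_iff_of_nonneg zero_le_one]
    exact fun i => (hus i).le
  · exact Filter.Eventually.of_forall fun us t ht =>
      hasDerivAt_signal_integrand u c hα i ((half_pos (hα i)).trans_le ht.1) us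

end Symmetrization

/-- Lemma 9: if `α_1 = max_i α_i`, all `α_i > 0`, and `α_1 > min_i α_i`, then the
partial derivative of `H_signal` with respect to `α_1` (the coordinate of index `0`)
is strictly positive. -/
theorem Hsignal_deriv_pos (k n : ℕ) (hk : 1 ≤ k) (hn : 2 ≤ n)
    (u : EuclideanSpace ℝ (Fin k)) (hu : ‖u‖ = 1)
    (c : ℝ) (hc0 : 0 < c) (hc2 : c ≤ 2)
    (α : Fin n → ℝ) (hpos : ∀ i, 0 < α i) (hmax : ∀ i, α i ≤ α (⟨0, by omega⟩ : Fin n))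
    (hne : ∃ i, α i < α (⟨0, by omega⟩ : Fin n)) :
    ∃ D : ℝ, 0 < D ∧
      HasDerivAt (fun t : ℝ => Hsignal k n u c (Function.update α (⟨0, by omega⟩ : Fin n) t)) D (α (⟨0, by omega⟩ : Fin n)) := by
  obtain ⟨m, rfl⟩ : ∃ m, k = m + 1 := ⟨k - 1, by omega⟩
  have := isProbabilityMeasure_sphereUniform_s8 m
  have hμ := ae_sphereUniform_norm_eq_one (m + 1)
  have hinv := measurePreserving_sphereUniform (m + 1)
  have hterm := fun j => integral_pairTerm_nonneg hμ hinv hu hc0 hc2 hpos (hmax j)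
  have hderiv := hasDerivAt_integral_signal hμ u c hpos (⟨0, by omega⟩ : Fin n)
  simp only [← signal_integrand_eq] at hderiv
  refine ⟨_, ?_, hderiv⟩
  obtain ⟨j, hj⟩ := hne
  refine Finset.sum_pos' (fun l _ => mul_nonneg (by linarith [hpos l]) (hterm l).1)
    ⟨j, Finset.mem_univ j, mul_pos (by linarith [hpos j]) ((hterm j).2 hj)⟩
end
end
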